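/- Let p be a prime and let A = ⊕_{n≥1} ℤ/p^{k_n} be a direct sum of cyclic p-groups with strictly increasing exponents satisfying k_{n+1} > 2·k_n for all n (and k_1 ≥ 1), with a_n denoting the generator of the n-th summand. Then the system of equations {x_n − p^{k_n − k_{n−1}}·x_{n+1} = a_n : n ≥ 1} (with k_0 = 0) has no solution in A: there is no sequence of elements x̃_n ∈ A satisfying all equations. -/

import Mathlib

/-- Below the diagonal, iterating the equations gives `x_0 = p^{k_n} x_{n+1}` in coordinate `m`. -/
theorem coord_eq_pow_mul {p : ℕ} {k : ℕ → ℕ} (hk : Monotone k)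
    {x : ℕ → Π₀ n : ℕ, ZMod (p ^ k n)}
    (h0 : x 0 - p ^ k 0 • x 1 = DFinsupp.single 0 1)
    (h : ∀ n, x (n + 1) - p ^ (k (n + 1) - k n) • x (n + 2) = DFinsupp.single (n + 1) 1)
    {m n : ℕ} (hn : n < m) : x 0 m = (p : ZMod (p ^ k m)) ^ k n * x (n + 1) m := by
  induction n with
  | zero =>
    have := DFunLike.congr_fun h0 m
    rw [DFinsupp.single_eq_of_ne (by omega)] at this
    simpa [sub_eq_zero] using this
  | succ n ih =>
    have := DFunLike.congr_fun (h n) m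
    rw [DFinsupp.single_eq_of_ne (by omega)] at this
    have hx : x (n + 1) m = (p : ZMod (p ^ k m)) ^ (k (n + 1) - k n) * x (n + 2) m := by
      simpa [sub_eq_zero] using this
    rw [ih (by omega), hx, ← mul_assoc, ← pow_add, Nat.add_sub_cancel' (hk n.le_succ)]

/-- The diagonal equation determines every coordinate of `x_0`. -/
theorem coord_succ_eq_pow {p : ℕ} {k : ℕ → ℕ} (hk : Monotone k)
    {x : ℕ → Π₀ n : ℕ, ZMod (p ^ k n)}
    (h0 : x 0 - p ^ k 0 • x 1 = DFinsupp.single 0 1)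
    (h : ∀ n, x (n + 1) - p ^ (k (n + 1) - k n) • x (n + 2) = DFinsupp.single (n + 1) 1)
    (n : ℕ) : x 0 (n + 1) = (p : ZMod (p ^ k (n + 1))) ^ k n := by
  have hx : x (n + 1) (n + 1) =
      1 + (p : ZMod (p ^ k (n + 1))) ^ (k (n + 1) - k n) * x (n + 2) (n + 1) := by
    have := DFunLike.congr_fun (h n) (n + 1)
    rw [DFinsupp.single_eq_same] at this
    simpa [sub_eq_iff_eq_add] using this
  have hp : (p : ZMod (p ^ k (n + 1))) ^ k (n + 1) = 0 := by
    exact_mod_cast ZMod.natCast_self (p ^ k (n + 1))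
  rw [coord_eq_pow_mul hk h0 h n.lt_succ_self, hx, mul_add, mul_one, ← mul_assoc, ← pow_add,
    Nat.add_sub_cancel' (hk n.le_succ), hp, zero_mul, add_zero]

/-- The system `{x_n - p^{k_n-k_{n-1}} x_{n+1} = a_n}` over
`⊕_{n≥1} ℤ/p^{k_n}` with `k_{n+1} > 2 k_n` has no solution in the group. -/
theorem no_solution_in_sum_of_cyclic_p_groups
    {p : ℕ} (hp : p.Prime) (k : ℕ → ℕ) (hk1 : 1 ≤ k 0)
    (hk : ∀ n, 2 * k n < k (n + 1)) :
    ¬ ∃ x : ℕ → Π₀ n : ℕ, ZMod (p ^ k n),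
      (x 0 - p ^ k 0 • x 1 = DFinsupp.single 0 1) ∧
      ∀ n, x (n + 1) - p ^ (k (n + 1) - k n) • x (n + 2) =
        DFinsupp.single (n + 1) 1 := by
  classical
  rintro ⟨x, h0, h⟩
  have hlt : ∀ n, k n < k (n + 1) := fun n => by have := hk n; omega
  obtain ⟨N, hN⟩ := Finset.exists_nat_subset_range (x 0).support
  have hzero : x 0 (N + 1) = 0 := by
    by_contra hne
    have := Finset.mem_range.1 (hN (DFinsupp.mem_support_iff.2 hne))
    omega
  rw [coord_succ_eq_pow (strictMono_nat_of_lt_succ hlt).monotone h0 h N, ← Nat.cast_pow,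
    ZMod.natCast_eq_zero_iff, Nat.pow_dvd_pow_iff_le_right hp.one_lt] at hzero
  exact (hlt N).not_ge hzero
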